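/- arXiv:2501.02413 — 4 statements merged into one kernel-verified Lean document; each statement's English description precedes it below -/
import Mathlib

section
/- For every E-graph G over a signature Σ, the induced relation ≈_G on ground terms (t1 ≈_G t2 iff some state of G accepts both t1 and t2) is a partial congruence relation: it is symmetric, transitive, congruent, and reachable. -/
set_option autoImplicit false

/-! ## Terms over a signature -/

inductive Tm (F : Type) (ar : F → ℕ) (V : Type) : Type where
  | var : V → Tm F ar V
  | node : (f : F) → (Fin (ar f) → Tm F ar V) → Tm F ar V

namespace Tm

variable {F : Type} {ar : F → ℕ} {V W : Type}

/-- Apply a renaming of variables/states. -/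
def map (σ : V → W) : Tm F ar V → Tm F ar W
  | .var v => .var (σ v)
  | .node f ts => .node f fun i => (ts i).map σ

/-- Apply a substitution. -/
def subst (σ : V → Tm F ar W) : Tm F ar V → Tm F ar W
  | .var v => σ v
  | .node f ts => .node f fun i => (ts i).subst σ

/-- The set of variables occurring in a pattern. -/
def vars : Tm F ar V → Set V
  | .var v => {v}
  | .node _ ts => ⋃ i, (ts i).vars

end Tm

/-- Ground terms: terms with no variables. -/
abbrev GTm (F : Type) (ar : F → ℕ) : Type := Tm F ar Empty

/-- A ground term viewed as a term over `Σ ∪ V`. -/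
def GTm.embed {F : Type} {ar : F → ℕ} {V : Type} (t : GTm F ar) : Tm F ar V :=
  Tm.map (fun e => e.elim) t

/-- The (reflexive) subterm relation. -/
inductive Subterm {F : Type} {ar : F → ℕ} {V : Type} : Tm F ar V → Tm F ar V → Prop where
  | refl (t : Tm F ar V) : Subterm t t
  | node {u : Tm F ar V} {f : F} {ts : Fin (ar f) → Tm F ar V} (i : Fin (ar f)) :
      Subterm u (ts i) → Subterm u (.node f ts)

theorem Subterm.trans' {F : Type} {ar : F → ℕ} {V : Type} {a b c : Tm F ar V}
    (h1 : Subterm a b) (h2 : Subterm b c) : Subterm a c := by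
  induction h2 with
  | refl => exact h1
  | node i _ ih => exact Subterm.node i ih

theorem Subterm.child {F : Type} {ar : F → ℕ} {V : Type} {f : F}
    {ts : Fin (ar f) → Tm F ar V} {c : Tm F ar V} (i : Fin (ar f))
    (h : Subterm (.node f ts) c) : Subterm (ts i) c :=
  Subterm.trans' (Subterm.node i (Subterm.refl _)) h

/-! ## Tree automata and E-graphs -/

/-- A (bottom-up, possibly infinite) tree automaton: a set of states together with
transitions `f(q₁,…,qₖ) → q`. -/
structure Automaton (F : Type) (ar : F → ℕ) : Type 1 where
  Q : Type
  trans : (f : F) → Set ((Fin (ar f) → Q) × Q)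

/-- `Accepts A t q` formalizes `t →*_A q`: the term `t ∈ T(Σ ∪ Q)` rewrites to the state `q`. -/
inductive Accepts {F : Type} {ar : F → ℕ} (A : Automaton F ar) : Tm F ar A.Q → A.Q → Prop where
  | var (q : A.Q) : Accepts A (.var q) q
  | node {f : F} {ts : Fin (ar f) → Tm F ar A.Q} {qs : Fin (ar f) → A.Q} {q : A.Q} :
      (∀ i, Accepts A (ts i) (qs i)) → (qs, q) ∈ A.trans f → Accepts A (.node f ts) q

/-- A ground term `t ∈ T(Σ)` is accepted by the state `q`, i.e. `t →*_A q`. -/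
def Automaton.AcceptsG {F : Type} {ar : F → ℕ} (A : Automaton F ar) (t : GTm F ar) (q : A.Q) : Prop :=
  Accepts A (GTm.embed t) q

/-- Deterministic: every ground term is accepted by at most one state. -/
def Automaton.Deterministic {F : Type} {ar : F → ℕ} (A : Automaton F ar) : Prop :=
  ∀ (t : GTm F ar) (q1 q2 : A.Q), A.AcceptsG t q1 → A.AcceptsG t q2 → q1 = q2

/-- Reachable: every state accepts some ground term. -/
def Automaton.ReachableA {F : Type} {ar : F → ℕ} (A : Automaton F ar) : Prop :=
  ∀ q : A.Q, ∃ t : GTm F ar, A.AcceptsG t q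

/-- An E-graph is a deterministic and reachable tree automaton. -/
structure EGraph (F : Type) (ar : F → ℕ) extends Automaton F ar where
  det : toAutomaton.Deterministic
  reach : toAutomaton.ReachableA

/-- A homomorphism of tree automata: maps states to states, preserving all transitions. -/
structure AHom {F : Type} {ar : F → ℕ} (A B : Automaton F ar) : Type where
  toFun : A.Q → B.Q
  map_trans : ∀ (f : F) (qs : Fin (ar f) → A.Q) (q : A.Q),
    (qs, q) ∈ A.trans f → (fun i => toFun (qs i), toFun q) ∈ B.trans f

/-- `A ⊑ B` : there exists a homomorphism from `A` to `B`. -/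
def ALe {F : Type} {ar : F → ℕ} (A B : Automaton F ar) : Prop := Nonempty (AHom A B)

def EGraph.Le {F : Type} {ar : F → ℕ} (G H : EGraph F ar) : Prop :=
  ALe G.toAutomaton H.toAutomaton

/-- Isomorphism of E-graphs: mutually inverse homomorphisms. -/
def EGraph.Iso {F : Type} {ar : F → ℕ} (G H : EGraph F ar) : Prop :=
  ∃ (h : AHom G.toAutomaton H.toAutomaton) (h' : AHom H.toAutomaton G.toAutomaton),
    (∀ q, h'.toFun (h.toFun q) = q) ∧ (∀ q, h.toFun (h'.toFun q) = q)

/-- The partial congruence relation `≈_G` induced by an E-graph: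
two ground terms are related iff some state accepts both. -/
def EGraph.eqv {F : Type} {ar : F → ℕ} (G : EGraph F ar) (t1 t2 : GTm F ar) : Prop :=
  ∃ q : G.Q, G.toAutomaton.AcceptsG t1 q ∧ G.toAutomaton.AcceptsG t2 q

/-- A finite E-graph: finitely many states and transitions. -/
def EGraph.IsFinite {F : Type} {ar : F → ℕ} (G : EGraph F ar) : Prop :=
  Finite G.Q ∧ ∀ f : F, (G.trans f).Finite

/-! ## Partial congruence relations -/

/-- A partial congruence relation (PCR) on ground terms: a symmetric, transitive,
congruent and reachable binary relation. -/
structure IsPCR {F : Type} {ar : F → ℕ} (E : GTm F ar → GTm F ar → Prop) : Prop where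
  symm : ∀ {t1 t2 : GTm F ar}, E t1 t2 → E t2 t1
  trans : ∀ {t1 t2 t3 : GTm F ar}, E t1 t2 → E t2 t3 → E t1 t3
  congruent : ∀ (f : F) (s t : Fin (ar f) → GTm F ar),
    (∀ i, E (s i) (t i)) → E (.node f s) (.node f s) → E (.node f s) (.node f t)
  reachable : ∀ (f : F) (s : Fin (ar f) → GTm F ar),
    E (.node f s) (.node f s) → ∀ i, E (s i) (s i)

/-- The join of two PCRs: the smallest PCR containing both. -/
def joinPCR {F : Type} {ar : F → ℕ} (E1 E2 : GTm F ar → GTm F ar → Prop)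
    (a b : GTm F ar) : Prop :=
  ∀ E : GTm F ar → GTm F ar → Prop, IsPCR E →
    (∀ x y, E1 x y → E x y) → (∀ x y, E2 x y → E x y) → E a b

/-! ## Term rewriting systems -/

/-- A term rewriting system: a finite set of rules `lhs → rhs` between patterns
(terms with variables drawn from `ℕ`), with `Var(rhs) ⊆ Var(lhs)`. -/
structure TRS (F : Type) (ar : F → ℕ) where
  rules : Set (Tm F ar ℕ × Tm F ar ℕ)
  finite : rules.Finite
  var_cond : ∀ r ∈ rules, Tm.vars r.2 ⊆ Tm.vars r.1

/-- The ground rewrite relation `→_R` determined by a TRS. -/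
inductive RWStep {F : Type} {ar : F → ℕ} (R : TRS F ar) : GTm F ar → GTm F ar → Prop where
  | rule {l r : Tm F ar ℕ} (h : (l, r) ∈ R.rules) (σ : ℕ → GTm F ar) :
      RWStep R (l.subst σ) (r.subst σ)
  | congr {f : F} {ts : Fin (ar f) → GTm F ar} {i : Fin (ar f)} {u : GTm F ar} :
      RWStep R (ts i) u → RWStep R (.node f ts) (.node f (Function.update ts i u))

/-- `≈_R` : the reflexive-symmetric-transitive closure of `→_R`. -/
def TRSEqv {F : Type} {ar : F → ℕ} (R : TRS F ar) : GTm F ar → GTm F ar → Prop :=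
  Relation.ReflTransGen fun a b => RWStep R a b ∨ RWStep R b a

/-! ## E-matching, insertion and congruence closure -/

/-- An e-match of a rule in an E-graph: a substitution `σ` into E-classes and a root
E-class `c` with `lhs[σ] →*_G c`. -/
structure EMatch {F : Type} {ar : F → ℕ} (R : TRS F ar) (G : EGraph F ar) : Type where
  lhs : Tm F ar ℕ
  rhs : Tm F ar ℕ
  mem : (lhs, rhs) ∈ R.rules
  sub : ℕ → G.Q
  root : G.Q
  acc : Accepts G.toAutomaton (Tm.map sub lhs) root

/-- Fresh states of the flattenings added by the match/apply operator: one state per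
(match, subterm of the instantiated right-hand side). -/
def MExtra {F : Type} {ar : F → ℕ} (R : TRS F ar) (G : EGraph F ar) : Type :=
  { p : EMatch R G × Tm F ar G.Q // Subterm p.2 (Tm.map p.1.sub p.1.rhs) }

open Classical in
/-- The state of the flattening `FL(rhs[σ] →* c)` associated to a subterm `u` of `rhs[σ]`:
states at the leaves are kept, the root is mapped to `c = root`, and all other subterms
get a fresh state. -/
noncomputable def stateOf {F : Type} {ar : F → ℕ} (R : TRS F ar) (G : EGraph F ar)
    (m : EMatch R G) :
    (u : Tm F ar G.Q) → Subterm u (Tm.map m.sub m.rhs) → G.Q ⊕ MExtra R G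
  | .var q, _ => Sum.inl q
  | .node f ts, h =>
      if Tm.node f ts = Tm.map m.sub m.rhs then Sum.inl m.root
      else Sum.inr ⟨(m, Tm.node f ts), h⟩

/-- The match/apply operator `T_R`: the (possibly non-deterministic) tree automaton
obtained from `G` by inserting the flattening `FL(rhs[σ] →* c)` for every e-match. -/
noncomputable def TRaut {F : Type} {ar : F → ℕ} (R : TRS F ar) (G : EGraph F ar) :
    Automaton F ar where
  Q := G.Q ⊕ MExtra R G
  trans f := { p |
    (∃ (qs : Fin (ar f) → G.Q) (q : G.Q), (qs, q) ∈ G.trans f ∧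
      p = (fun i => Sum.inl (qs i), Sum.inl q)) ∨
    (∃ (m : EMatch R G) (ts : Fin (ar f) → Tm F ar G.Q)
        (h : Subterm (.node f ts) (Tm.map m.sub m.rhs)),
      p = (fun i => stateOf R G m (ts i) (Subterm.child i h),
           stateOf R G m (.node f ts) h)) }

/-- `G` is the congruence closure (rebuilding) of the automaton `A`: the ⊑-least E-graph
above `A`. -/
def IsCC {F : Type} {ar : F → ℕ} (A : Automaton F ar) (G : EGraph F ar) : Prop :=
  ALe A G.toAutomaton ∧ ∀ H : EGraph F ar, ALe A H.toAutomaton → EGraph.Le G H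

/-- `H` is (up to isomorphism) the result of the immediate consequence operator
`ICO_R = CC ∘ T_R` applied to `G`. -/
def IsICO {F : Type} {ar : F → ℕ} (R : TRS F ar) (G H : EGraph F ar) : Prop :=
  IsCC (TRaut R G) H

/-- `S` is the sequence of iterates `S i = ICO_R^(i)(G)`. -/
def IterSeq {F : Type} {ar : F → ℕ} (R : TRS F ar) (G : EGraph F ar)
    (S : ℕ → EGraph F ar) : Prop :=
  S 0 = G ∧ ∀ i, IsICO R (S i) (S (i + 1))

/-- `H` is a least upper bound of the sequence `S` of E-graphs. -/
def IsLUBseq {F : Type} {ar : F → ℕ} (S : ℕ → EGraph F ar) (H : EGraph F ar) : Prop :=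
  (∀ i, (S i).Le H) ∧ ∀ H' : EGraph F ar, (∀ i, (S i).Le H') → H.Le H'

/-- `H` is a least upper bound of the family `Gs` of E-graphs. -/
def IsLUBfam {F : Type} {ar : F → ℕ} {I : Type} (Gs : I → EGraph F ar)
    (H : EGraph F ar) : Prop :=
  (∀ i, (Gs i).Le H) ∧ ∀ H' : EGraph F ar, (∀ i, (Gs i).Le H') → H.Le H'

/-- `H = EqSat(R, G) = ⊔_{i ≥ 0} ICO_R^(i)(G)`. -/
def IsEqSat {F : Type} {ar : F → ℕ} (R : TRS F ar) (G H : EGraph F ar) : Prop :=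
  ∃ S : ℕ → EGraph F ar, IterSeq R G S ∧ IsLUBseq S H

/-- `H` is a model of the TRS `R`. -/
def ModelTRS {F : Type} {ar : F → ℕ} (R : TRS F ar) (H : EGraph F ar) : Prop :=
  ∀ r ∈ R.rules, ∀ (σ : ℕ → H.Q) (c : H.Q),
    Accepts H.toAutomaton (Tm.map σ r.1) c → Accepts H.toAutomaton (Tm.map σ r.2) c

/-- `H` is a model of the pair `(R, G)`. -/
def IsModelOf {F : Type} {ar : F → ℕ} (R : TRS F ar) (G H : EGraph F ar) : Prop :=
  G.Le H ∧ ModelTRS R H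

/-- `H` is a universal model of the pair `(R, G)`. -/
def IsUniversalModel {F : Type} {ar : F → ℕ} (R : TRS F ar) (G H : EGraph F ar) : Prop :=
  IsModelOf R G H ∧ ∀ H' : EGraph F ar, IsModelOf R G H' → H.Le H'

/-- `G` is (up to isomorphism) the flattening `FL(t →* c)` of a ground term `t`:
the ⊑-least E-graph representing `t`. -/
def IsTermEG {F : Type} {ar : F → ℕ} (t : GTm F ar) (G : EGraph F ar) : Prop :=
  (∃ c, G.toAutomaton.AcceptsG t c) ∧
  ∀ H : EGraph F ar, (∃ c, H.toAutomaton.AcceptsG t c) → G.Le H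

/-- Equality saturation terminates on `(R, G)`: the sequence of iterates
`ICO_R^(i)(G)` is eventually constant up to isomorphism. -/
def EqSatTerminates {F : Type} {ar : F → ℕ} (R : TRS F ar) (G : EGraph F ar) : Prop :=
  ∃ S : ℕ → EGraph F ar, IterSeq R G S ∧ ∃ n, ∀ m, n ≤ m → (S m).Iso (S n)

theorem Automaton.acceptsG_node_iff {F : Type} {ar : F → ℕ} (A : Automaton F ar) (f : F)
    (s : Fin (ar f) → GTm F ar) (q : A.Q) :
    A.AcceptsG (.node f s) q ↔
      ∃ qs : Fin (ar f) → A.Q, (∀ i, A.AcceptsG (s i) (qs i)) ∧ (qs, q) ∈ A.trans f := by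
  constructor
  · intro h
    simp only [Automaton.AcceptsG, GTm.embed, Tm.map] at h
    cases h with
    | node hs hq => exact ⟨_, hs, hq⟩
  · rintro ⟨qs, hs, hq⟩
    simp only [Automaton.AcceptsG, GTm.embed, Tm.map]
    exact Accepts.node hs hq

/-- For every E-graph `G`, the induced relation `≈_G` is a partial congruence relation:
symmetric, transitive, congruent, and reachable. -/
theorem egraph_eqv_isPCR {F : Type} {ar : F → ℕ} [Finite F] (G : EGraph F ar) :
    IsPCR G.eqv := by
  exact
    { symm := fun ⟨q, h1, h2⟩ => ⟨q, h2, h1⟩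
      trans := by
        rintro t1 t2 t3 ⟨q, h1, h2⟩ ⟨q', h2', h3⟩
        obtain rfl := G.det t2 q q' h2 h2'
        exact ⟨q, h1, h3⟩
      congruent := by
        rintro f s t hst ⟨q, hs, -⟩
        obtain ⟨qs, hqs, hq⟩ := (G.acceptsG_node_iff f s q).1 hs
        refine ⟨q, hs, (G.acceptsG_node_iff f t q).2 ⟨qs, fun i => ?_, hq⟩⟩
        obtain ⟨p, hp, hp'⟩ := hst i
        rwa [G.det (s i) (qs i) p (hqs i) hp]
      reachable := by
        rintro f s ⟨q, hs, -⟩ i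
        obtain ⟨qs, hqs, -⟩ := (G.acceptsG_node_iff f s q).1 hs
        exact ⟨qs i, hqs i, hqs i⟩ }
end

section
/- For every partial congruence relation ≈ on T(Σ) there exists an E-graph G, unique up to isomorphism, such that the induced relation ≈_G equals ≈. -/
set_option autoImplicit false

/-- A node is accepted exactly when its children are accepted by the premises of a transition. -/
theorem Automaton.acceptsG_node {F : Type} {ar : F → ℕ} {A : Automaton F ar} {f : F}
    {ts : Fin (ar f) → GTm F ar} {q : A.Q} :
    A.AcceptsG (.node f ts) q ↔
      ∃ qs : Fin (ar f) → A.Q, (∀ i, A.AcceptsG (ts i) (qs i)) ∧ (qs, q) ∈ A.trans f := by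
  constructor
  · intro h
    change Accepts A (.node f fun i => GTm.embed (ts i)) q at h
    cases h with
    | node h1 h2 => exact ⟨_, h1, h2⟩
  · rintro ⟨qs, h1, h2⟩
    exact Accepts.node (ts := fun i => GTm.embed (ts i)) h1 h2

/-- The automaton whose states are the equivalence classes of a relation on ground terms. -/
def classAutomaton {F : Type} {ar : F → ℕ} (E : GTm F ar → GTm F ar → Prop) :
    Automaton F ar where
  Q := { S : Set (GTm F ar) // ∃ t, E t t ∧ S = { u | E t u } }
  trans f := { p | ∃ s : Fin (ar f) → GTm F ar, (∀ i, s i ∈ (p.1 i).1) ∧ .node f s ∈ p.2.1 }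

namespace IsPCR

variable {F : Type} {ar : F → ℕ} {E : GTm F ar → GTm F ar → Prop}

theorem rel_of_mem (hE : IsPCR E) {q : (classAutomaton E).Q} {t u : GTm F ar}
    (ht : t ∈ q.1) (hu : u ∈ q.1) : E t u := by
  obtain ⟨S, a, ha, rfl⟩ := q
  exact hE.trans (hE.symm ht) hu

theorem mem_of_rel (hE : IsPCR E) {q : (classAutomaton E).Q} {t u : GTm F ar}
    (ht : t ∈ q.1) (h : E t u) : u ∈ q.1 := by
  obtain ⟨S, a, ha, rfl⟩ := q
  exact hE.trans ht h

theorem acceptsG_classAutomaton (hE : IsPCR E) (t : GTm F ar) (q : (classAutomaton E).Q) :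
    (classAutomaton E).AcceptsG t q ↔ t ∈ q.1 := by
  induction t generalizing q with
  | var e => exact e.elim
  | node f ts ih =>
    rw [Automaton.acceptsG_node]
    constructor
    · rintro ⟨qs, h, s, hs, hq⟩
      exact hE.mem_of_rel hq <| hE.congruent f s ts
        (fun i => hE.rel_of_mem (hs i) ((ih i _).1 (h i))) (hE.rel_of_mem hq hq)
    · intro h
      have hr := hE.reachable f ts (hE.rel_of_mem h h)
      exact ⟨fun i => ⟨{ u | E (ts i) u }, ts i, hr i, rfl⟩, fun i => (ih i _).2 (hr i),
        ts, hr, h⟩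

/-- The E-graph of equivalence classes of a partial congruence relation. -/
def egraph (hE : IsPCR E) : EGraph F ar where
  toAutomaton := classAutomaton E
  det t q1 q2 h1 h2 := by
    rw [hE.acceptsG_classAutomaton] at h1 h2
    exact Subtype.ext <| Set.ext fun u =>
      ⟨fun h => hE.mem_of_rel h2 (hE.rel_of_mem h1 h),
        fun h => hE.mem_of_rel h1 (hE.rel_of_mem h2 h)⟩
  reach := by
    intro q
    obtain ⟨t, ht, hq⟩ := q.2
    exact ⟨t, (hE.acceptsG_classAutomaton t q).2 (hq ▸ ht)⟩

theorem egraph_eqv (hE : IsPCR E) (t1 t2 : GTm F ar) : hE.egraph.eqv t1 t2 ↔ E t1 t2 := by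
  constructor
  · rintro ⟨q, h1, h2⟩
    exact hE.rel_of_mem ((hE.acceptsG_classAutomaton t1 q).1 h1)
      ((hE.acceptsG_classAutomaton t2 q).1 h2)
  · intro h
    have h1 : E t1 t1 := hE.trans h (hE.symm h)
    exact ⟨⟨{ u | E t1 u }, t1, h1, rfl⟩, (hE.acceptsG_classAutomaton _ _).2 h1,
      (hE.acceptsG_classAutomaton _ _).2 h⟩

end IsPCR

/-- An inclusion of induced relations yields a homomorphism that preserves acceptance. -/
theorem EGraph.exists_hom_of_eqv_imp {F : Type} {ar : F → ℕ} (G H : EGraph F ar)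
    (hGH : ∀ t1 t2, G.eqv t1 t2 → H.eqv t1 t2) :
    ∃ h : AHom G.toAutomaton H.toAutomaton, ∀ t q, G.AcceptsG t q → H.AcceptsG t (h.toFun q) := by
  choose rep hrep using G.reach
  have ex (q : G.Q) : ∃ q' : H.Q, H.AcceptsG (rep q) q' := by
    obtain ⟨q', h, -⟩ := hGH _ _ ⟨q, hrep q, hrep q⟩
    exact ⟨q', h⟩
  choose g hg using ex
  have acc : ∀ t q, G.AcceptsG t q → H.AcceptsG t (g q) := by
    intro t q h
    obtain ⟨q', h1, h2⟩ := hGH _ _ ⟨q, hrep q, h⟩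
    rwa [H.det _ _ _ (hg q) h1]
  refine ⟨⟨g, fun f qs q h => ?_⟩, acc⟩
  obtain ⟨qs', h1, h2⟩ := Automaton.acceptsG_node.1
    (acc _ q (Automaton.acceptsG_node.2 ⟨qs, fun i => hrep (qs i), h⟩))
  rwa [funext fun i => H.det _ _ _ (h1 i) (hg (qs i))] at h2

/-- E-graphs inducing the same relation are isomorphic. -/
theorem EGraph.iso_of_eqv_iff {F : Type} {ar : F → ℕ} {G H : EGraph F ar}
    (hGH : ∀ t1 t2, G.eqv t1 t2 ↔ H.eqv t1 t2) : G.Iso H := by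
  obtain ⟨h, hh⟩ := G.exists_hom_of_eqv_imp H fun t1 t2 => (hGH t1 t2).1
  obtain ⟨k, hk⟩ := H.exists_hom_of_eqv_imp G fun t1 t2 => (hGH t1 t2).2
  refine ⟨h, k, fun q => ?_, fun q => ?_⟩
  · obtain ⟨t, ht⟩ := G.reach q
    exact G.det t _ _ (hk _ _ (hh _ _ ht)) ht
  · obtain ⟨t, ht⟩ := H.reach q
    exact H.det t _ _ (hh _ _ (hk _ _ ht)) ht

/-- For every partial congruence relation `≈` on `T(Σ)` there exists an E-graph `G`,
unique up to isomorphism, whose induced relation `≈_G` equals `≈`. -/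
theorem exists_unique_egraph_of_PCR {F : Type} {ar : F → ℕ} [Finite F]
    (E : GTm F ar → GTm F ar → Prop) (hE : IsPCR E) :
    (∃ G : EGraph F ar, ∀ t1 t2, G.eqv t1 t2 ↔ E t1 t2) ∧
    (∀ G G' : EGraph F ar, (∀ t1 t2, G.eqv t1 t2 ↔ E t1 t2) →
      (∀ t1 t2, G'.eqv t1 t2 ↔ E t1 t2) → G.Iso G') := by
  exact ⟨⟨hE.egraph, hE.egraph_eqv⟩, fun G G' h h' =>
    EGraph.iso_of_eqv_iff fun t1 t2 => (h t1 t2).trans (h' t1 t2).symm⟩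
end

section
/- Between any two E-graphs G and H over the same signature there exists at most one homomorphism h : G → H. In particular every E-graph is a rigid tree automaton: the identity is its only endomorphism. -/
set_option autoImplicit false

/-- A homomorphism sends accepting runs to accepting runs of the renamed term. -/
theorem Accepts.map {F : Type} {ar : F → ℕ} {A B : Automaton F ar} (h : AHom A B)
    {t : Tm F ar A.Q} {q : A.Q} (ht : Accepts A t q) :
    Accepts B (Tm.map h.toFun t) (h.toFun q) := by
  induction ht with
  | var q => exact .var _
  | node _ hq ih => exact .node ih (h.map_trans _ _ _ hq)

theorem Tm.map_map {F : Type} {ar : F → ℕ} {U V W : Type} (σ : U → V) (τ : V → W)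
    (t : Tm F ar U) : (t.map σ).map τ = t.map (τ ∘ σ) := by
  induction t with
  | var v => rfl
  | node f ts ih => simp only [Tm.map, ih]

theorem GTm.map_embed {F : Type} {ar : F → ℕ} {V W : Type} (σ : V → W) (t : GTm F ar) :
    Tm.map σ t.embed = t.embed := by
  rw [GTm.embed, GTm.embed, Tm.map_map]
  congr 1
  exact Subsingleton.elim _ _

/-- A homomorphism preserves acceptance of ground terms. -/
theorem Automaton.AcceptsG.map {F : Type} {ar : F → ℕ} {A B : Automaton F ar} (h : AHom A B)
    {t : GTm F ar} {q : A.Q} (ht : A.AcceptsG t q) : B.AcceptsG t (h.toFun q) := by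
  have := Accepts.map h ht
  rwa [GTm.map_embed] at this

/-- Two homomorphisms from a reachable automaton to a deterministic one agree. -/
theorem AHom.toFun_eq {F : Type} {ar : F → ℕ} {A B : Automaton F ar} (hA : A.ReachableA)
    (hB : B.Deterministic) (h1 h2 : AHom A B) : h1.toFun = h2.toFun := by
  funext q
  obtain ⟨t, ht⟩ := hA q
  exact hB t _ _ (ht.map h1) (ht.map h2)

/-- Between any two E-graphs there is at most one homomorphism; in particular every
E-graph is rigid: the identity is its only endomorphism. -/
theorem egraph_hom_unique {F : Type} {ar : F → ℕ} [Finite F] :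
    (∀ (G H : EGraph F ar) (h1 h2 : AHom G.toAutomaton H.toAutomaton),
      h1.toFun = h2.toFun) ∧
    (∀ (G : EGraph F ar) (h : AHom G.toAutomaton G.toAutomaton), ∀ q, h.toFun q = q) := by
  exact ⟨fun G H => AHom.toFun_eq G.reach H.det,
    fun G h => congrFun (AHom.toFun_eq G.reach G.det h ⟨id, fun _ _ _ hq => hq⟩)⟩
end

section
/- The relation ⊑ on E-graphs over a fixed signature (G ⊑ H iff there exists a homomorphism G → H) is a partial order up to isomorphism: it is reflexive, transitive, and if G ⊑ H and H ⊑ G then G and H are isomorphic. -/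
set_option autoImplicit false

/-- The identity homomorphism. -/
def AHom.id {F : Type} {ar : F → ℕ} (A : Automaton F ar) : AHom A A where
  toFun q := q
  map_trans _ _ _ hq := hq

/-- Composition of homomorphisms. -/
def AHom.comp {F : Type} {ar : F → ℕ} {A B C : Automaton F ar} (k : AHom B C) (h : AHom A B) :
    AHom A C where
  toFun q := k.toFun (h.toFun q)
  map_trans _ _ _ hq := k.map_trans _ _ _ (h.map_trans _ _ _ hq)

/-- An endomorphism of an E-graph is the identity. -/
theorem EGraph.endo_apply {F : Type} {ar : F → ℕ} (G : EGraph F ar)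
    (h : AHom G.toAutomaton G.toAutomaton) (q : G.Q) : h.toFun q = q := by
  obtain ⟨t, ht⟩ := G.reach q
  exact G.det t _ _ (ht.map h) ht

/-- `⊑` is a partial order on E-graphs up to isomorphism: reflexive, transitive, and
antisymmetric up to isomorphism. -/
theorem egraph_le_partialOrder {F : Type} {ar : F → ℕ} [Finite F] :
    (∀ G : EGraph F ar, G.Le G) ∧
    (∀ G H K : EGraph F ar, G.Le H → H.Le K → G.Le K) ∧
    (∀ G H : EGraph F ar, G.Le H → H.Le G → G.Iso H) := by
  refine ⟨fun G => ⟨AHom.id _⟩, ?_, ?_⟩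
  · rintro G H K ⟨h⟩ ⟨k⟩
    exact ⟨k.comp h⟩
  · rintro G H ⟨h⟩ ⟨k⟩
    exact ⟨h, k, G.endo_apply (k.comp h), H.endo_apply (h.comp k)⟩
end
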